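/- For any SQLP(R,D) program P, the least Herbrand model of P (i.e., the least, with respect to set inclusion, open Herbrand interpretation over (R,D) that is a model of every clause of P) exists and equals M_P = {A#d | P ⊢_{SQHL(R,D)} A#d}, the set of all D-qualified atoms derivable from P in the inference system SQHL(R,D). -/

import Mathlib

structure QualDom (D : Type*) [Lattice D] [BoundedOrder D] where
  att : D → D → D
  att_assoc : ∀ a b c : D, att (att a b) c = att a (att b c)
  att_comm : ∀ a b : D, att a b = att b a
  att_mono : ∀ a b c d : D, a ≤ b → c ≤ d → att a c ≤ att b d
  att_top : ∀ a : D, att a ⊤ = a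
  att_bot : ∀ a : D, att a ⊥ = ⊥
  att_strict : ∀ a b : D, a ≠ ⊥ → a ≠ ⊤ → b ≠ ⊥ → b ≠ ⊤ → att a b < b
  att_distrib_inf : ∀ a b c : D, att a (b ⊓ c) = att a b ⊓ att a c

mutual
  inductive Term (C : Type) (ar : C → ℕ) : Type where
    | var : ℕ → Term C ar
    | app : (c : C) → TermVec C ar (ar c) → Term C ar
  inductive TermVec (C : Type) (ar : C → ℕ) : ℕ → Type where
    | nil : TermVec C ar 0
    | cons {n : ℕ} : Term C ar → TermVec C ar n → TermVec C ar (n + 1)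
end

def Subst (C : Type) (ar : C → ℕ) : Type := ℕ → Term C ar

mutual
  def Term.subst {C : Type} {ar : C → ℕ} : Term C ar → Subst C ar → Term C ar
    | .var i, θ => θ i
    | .app c ts, θ => .app c (ts.subst θ)
  def TermVec.subst {C : Type} {ar : C → ℕ} :
      ∀ {n : ℕ}, TermVec C ar n → Subst C ar → TermVec C ar n
    | _, .nil, _ => .nil
    | _, .cons t ts, θ => .cons (t.subst θ) (ts.subst θ)
end

structure Atom (C Pd : Type) (ar : C → ℕ) (par : Pd → ℕ) : Type where
  pred : Pd
  args : TermVec C ar (par pred)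

def Atom.subst {C Pd : Type} {ar : C → ℕ} {par : Pd → ℕ}
    (A : Atom C Pd ar par) (θ : Subst C ar) : Atom C Pd ar par :=
  ⟨A.pred, A.args.subst θ⟩

structure SimRel (C Pd : Type) (ar : C → ℕ) (par : Pd → ℕ) (D : Type)
    [Lattice D] [BoundedOrder D] where
  simC : C → C → D
  simP : Pd → Pd → D
  simC_refl : ∀ c, simC c c = ⊤
  simC_symm : ∀ c c', simC c c' = simC c' c
  simC_trans : ∀ c c' c'', simC c c' ⊓ simC c' c'' ≤ simC c c''
  simP_refl : ∀ p, simP p p = ⊤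
  simP_symm : ∀ p p', simP p p' = simP p' p
  simP_trans : ∀ p p' p'', simP p p' ⊓ simP p' p'' ≤ simP p p''
  simC_arity : ∀ c c', simC c c' ≠ ⊥ → ar c = ar c'
  simP_arity : ∀ p p', simP p p' ≠ ⊥ → par p = par p'

variable {C Pd : Type} {ar : C → ℕ} {par : Pd → ℕ} {D : Type} [Lattice D] [BoundedOrder D]

mutual
  def termSim (R : SimRel C Pd ar par D) : Term C ar → Term C ar → D
    | .var i, .var j => if i = j then ⊤ else ⊥
    | .app c ts, .app c' ts' => R.simC c c' ⊓ vecSim R ts ts'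
    | _, _ => ⊥
  def vecSim (R : SimRel C Pd ar par D) :
      ∀ {n m : ℕ}, TermVec C ar n → TermVec C ar m → D
    | _, _, .nil, .nil => ⊤
    | _, _, .cons t ts, .cons s ss => termSim R t s ⊓ vecSim R ts ss
    | _, _, _, _ => ⊥
end

def atomSim (R : SimRel C Pd ar par D) (A A' : Atom C Pd ar par) : D :=
  R.simP A.pred A'.pred ⊓ vecSim R A.args A'.args

mutual
  def Term.maxVar {C : Type} {ar : C → ℕ} : Term C ar → ℕ
    | .var i => i + 1
    | .app _ ts => ts.maxVar
  def TermVec.maxVar {C : Type} {ar : C → ℕ} : ∀ {n : ℕ}, TermVec C ar n → ℕ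
    | _, .nil => 0
    | _, .cons t ts => max t.maxVar ts.maxVar
end

mutual
  def linTerm {C : Type} {ar : C → ℕ} :
      Term C ar → List ℕ → ℕ → Term C ar × List ℕ × ℕ × List (ℕ × ℕ)
    | .var x, seen, fresh =>
        if x ∈ seen then (.var fresh, seen, fresh + 1, [(x, fresh)])
        else (.var x, x :: seen, fresh, [])
    | .app c ts, seen, fresh =>
        let r := linVec ts seen fresh
        (.app c r.1, r.2.1, r.2.2.1, r.2.2.2)
  def linVec {C : Type} {ar : C → ℕ} :
      ∀ {n : ℕ}, TermVec C ar n → List ℕ → ℕ → TermVec C ar n × List ℕ × ℕ × List (ℕ × ℕ)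
    | _, .nil, seen, fresh => (.nil, seen, fresh, [])
    | _, .cons t ts, seen, fresh =>
        let r1 := linTerm t seen fresh
        let r2 := linVec ts r1.2.1 r1.2.2.1
        (.cons r1.1 r2.1, r2.2.1, r2.2.2.1, r1.2.2.2 ++ r2.2.2.2)
end

def linAtomFrom (A : Atom C Pd ar par) (start : ℕ) : Atom C Pd ar par × List (ℕ × ℕ) :=
  let r := linVec A.args [] start
  (⟨A.pred, r.1⟩, r.2.2.2)

def linAtom (A : Atom C Pd ar par) : Atom C Pd ar par × List (ℕ × ℕ) :=
  linAtomFrom A A.args.maxVar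

def infList (l : List D) : D := l.foldr (· ⊓ ·) ⊤

def condsInf (R : SimRel C Pd ar par D) (θ : Subst C ar) (conds : List (ℕ × ℕ)) : D :=
  infList (conds.map fun p => termSim R (θ p.1) (θ p.2))

def RInstAtom (R : SimRel C Pd ar par D) (A A' : Atom C Pd ar par) (δ : D) : Prop :=
  ∃ (As : Atom C Pd ar par) (θ : Subst C ar),
    A' = As.subst θ ∧
    δ = atomSim R (linAtom A).1 As ⊓ condsInf R θ (linAtom A).2 ∧
    δ ≠ ⊥

structure Clause (C Pd : Type) (ar : C → ℕ) (par : Pd → ℕ) (D : Type) : Type where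
  head : Atom C Pd ar par
  att : D
  body : List (Atom C Pd ar par)

def Clause.maxVar (Cl : Clause C Pd ar par D) : ℕ :=
  max Cl.head.args.maxVar (Cl.body.foldr (fun B m => max B.args.maxVar m) 0)

def Clause.linHead (Cl : Clause C Pd ar par D) : Atom C Pd ar par × List (ℕ × ℕ) :=
  linAtomFrom Cl.head Cl.maxVar

def RInstClause (R : SimRel C Pd ar par D) (Cl Cl' : Clause C Pd ar par D) (δ : D) : Prop :=
  ∃ (As : Atom C Pd ar par) (θ : Subst C ar),
    δ = atomSim R Cl.linHead.1 As ⊓ condsInf R θ Cl.linHead.2 ∧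
    δ ≠ ⊥ ∧
    Cl' = ⟨As.subst θ, Cl.att, Cl.body.map (Atom.subst · θ)⟩

def entailsD (A : Atom C Pd ar par) (d : D) (A' : Atom C Pd ar par) (d' : D) : Prop :=
  ∃ θ : Subst C ar, A' = A.subst θ ∧ d' ≤ d

def entailsRD (R : SimRel C Pd ar par D) (Q : QualDom D) (A : Atom C Pd ar par) (d : D)
    (A' : Atom C Pd ar par) (d' : D) : Prop :=
  ∃ δ : D, RInstAtom R A A' δ ∧ d' ≤ Q.att d δ

def QAtom (C Pd : Type) (ar : C → ℕ) (par : Pd → ℕ) (D : Type)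
    [Lattice D] [BoundedOrder D] : Type :=
  {p : Atom C Pd ar par × D // p.2 ≠ ⊥}

def IsInterp (R : SimRel C Pd ar par D) (Q : QualDom D)
    (I : Set (QAtom C Pd ar par D)) : Prop :=
  ∀ a ∈ I, ∀ b : QAtom C Pd ar par D, entailsRD R Q a.1.1 a.1.2 b.1.1 b.1.2 → b ∈ I

def memQ (I : Set (QAtom C Pd ar par D)) (A : Atom C Pd ar par) (d : D) : Prop :=
  ∃ q ∈ I, q.1 = (A, d)

inductive SQHL (R : SimRel C Pd ar par D) (Q : QualDom D)
    (Pr : List (Clause C Pd ar par D)) : Atom C Pd ar par → D → Prop where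
  | mp (Cl : Clause C Pd ar par D) (hCl : Cl ∈ Pr) (Cl' : Clause C Pd ar par D) (δ : D)
      (ds : List D) (d' : D)
      (hinst : RInstClause R Cl Cl' δ)
      (hlen : ds.length = Cl'.body.length)
      (hprem : ∀ (i : ℕ) (h1 : i < Cl'.body.length) (h2 : i < ds.length),
        SQHL R Q Pr (Cl'.body.get ⟨i, h1⟩) (ds.get ⟨i, h2⟩))
      (hd' : d' ≠ ⊥)
      (hle : d' ≤ Q.att Cl.att (δ ⊓ infList ds)) :
      SQHL R Q Pr Cl'.head d'

def IsClauseModel (R : SimRel C Pd ar par D) (Q : QualDom D)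
    (I : Set (QAtom C Pd ar par D)) (Cl : Clause C Pd ar par D) : Prop :=
  ∀ (Cl' : Clause C Pd ar par D) (δ : D), RInstClause R Cl Cl' δ →
    ∀ ds : List D, ds.length = Cl'.body.length →
      (∀ (i : ℕ) (h1 : i < Cl'.body.length) (h2 : i < ds.length),
        memQ I (Cl'.body.get ⟨i, h1⟩) (ds.get ⟨i, h2⟩)) →
      ∀ e : D, e = Q.att Cl.att (δ ⊓ infList ds) → e ≠ ⊥ → memQ I Cl'.head e

def IsModel (R : SimRel C Pd ar par D) (Q : QualDom D)
    (Pr : List (Clause C Pd ar par D)) (I : Set (QAtom C Pd ar par D)) : Prop :=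
  ∀ Cl ∈ Pr, IsClauseModel R Q I Cl

def ExtP (Pd : Type) (D : Type) : Type := Pd ⊕ Unit ⊕ D

def extPar (par : Pd → ℕ) (D : Type) : ExtP Pd D → ℕ :=
  Sum.elim par (Sum.elim (fun _ => 2) (fun _ => 0))

def Atom.embed (A : Atom C Pd ar par) : Atom C (ExtP Pd D) ar (extPar par D) :=
  ⟨Sum.inl A.pred, A.args⟩

def simAtom (t s : Term C ar) : Atom C (ExtP Pd D) ar (extPar par D) :=
  ⟨Sum.inr (Sum.inl ()), .cons t (.cons s .nil)⟩

def payAtom (w : D) : Atom C (ExtP Pd D) ar (extPar par D) :=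
  ⟨Sum.inr (Sum.inr w), .nil⟩

def condAtoms (conds : List (ℕ × ℕ)) : List (Atom C (ExtP Pd D) ar (extPar par D)) :=
  conds.map fun p => simAtom (.var p.1) (.var p.2)

def varVec (C : Type) (ar : C → ℕ) : ℕ → (n : ℕ) → TermVec C ar n
  | _, 0 => .nil
  | start, n + 1 => .cons (.var start) (varVec C ar (start + 1) n)

def simConds (n : ℕ) : List (Atom C (ExtP Pd D) ar (extPar par D)) :=
  (List.range n).map fun i => simAtom (.var i) (.var (n + i))

def transPS (R : SimRel C Pd ar par D) (Pr : List (Clause C Pd ar par D)) :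
    Set (Clause C (ExtP Pd D) ar (extPar par D) D) :=
  {Cl' | ∃ Cl ∈ Pr, ∃ H' : Atom C Pd ar par,
    atomSim R (Clause.linHead Cl).1 H' ≠ ⊥ ∧
    Cl' = ⟨Atom.embed H', Cl.att,
      payAtom (atomSim R (Clause.linHead Cl).1 H') ::
        (condAtoms (Clause.linHead Cl).2 ++ Cl.body.map Atom.embed)⟩}

def transSim (R : SimRel C Pd ar par D) :
    Set (Clause C (ExtP Pd D) ar (extPar par D) D) :=
  {⟨simAtom (.var 0) (.var 0), ⊤, []⟩} ∪
  {Cl' | ∃ c c' : C, R.simC c c' ≠ ⊥ ∧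
    Cl' = ⟨simAtom (.app c (varVec C ar 0 (ar c))) (.app c' (varVec C ar (ar c) (ar c'))), ⊤,
           payAtom (R.simC c c') :: simConds (ar c)⟩}

def payWeights (R : SimRel C Pd ar par D) (Pr : List (Clause C Pd ar par D)) : Set D :=
  {w | ∃ Cl ∈ Pr, ∃ H' : Atom C Pd ar par,
      atomSim R (Clause.linHead Cl).1 H' ≠ ⊥ ∧ w = atomSim R (Clause.linHead Cl).1 H'} ∪
  {w | ∃ c c' : C, R.simC c c' ≠ ⊥ ∧ w = R.simC c c'}

def transPay (R : SimRel C Pd ar par D) (Pr : List (Clause C Pd ar par D)) :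
    Set (Clause C (ExtP Pd D) ar (extPar par D) D) :=
  {Cl' | ∃ w ∈ payWeights R Pr, Cl' = ⟨payAtom w, w, []⟩}

def transProg (R : SimRel C Pd ar par D) (Pr : List (Clause C Pd ar par D)) :
    Set (Clause C (ExtP Pd D) ar (extPar par D) D) :=
  transPS R Pr ∪ transSim R ∪ transPay R Pr

inductive QHL {Pd' : Type} {par' : Pd' → ℕ} (Q : QualDom D)
    (Pr : Set (Clause C Pd' ar par' D)) : Atom C Pd' ar par' → D → Prop where
  | mp (Cl : Clause C Pd' ar par' D) (hCl : Cl ∈ Pr) (θ : Subst C ar) (ds : List D) (d' : D)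
      (hlen : ds.length = Cl.body.length)
      (hprem : ∀ (i : ℕ) (h1 : i < Cl.body.length) (h2 : i < ds.length),
        QHL Q Pr ((Cl.body.get ⟨i, h1⟩).subst θ) (ds.get ⟨i, h2⟩))
      (hd' : d' ≠ ⊥)
      (hle : d' ≤ Q.att Cl.att (infList ds)) :
      QHL Q Pr (Cl.head.subst θ) d'

mutual
  theorem termSim_refl (R : SimRel C Pd ar par D) : ∀ t : Term C ar, termSim R t t = ⊤
    | .var i => by simp [termSim]
    | .app c ts => by simp [termSim, R.simC_refl, vecSim_refl R ts]
  theorem vecSim_refl (R : SimRel C Pd ar par D) :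
      ∀ {n : ℕ} (ts : TermVec C ar n), vecSim R ts ts = ⊤
    | _, .nil => by simp [vecSim]
    | _, .cons t ts => by simp [vecSim, termSim_refl R t, vecSim_refl R ts]
end

theorem termSim_var_of_ne (R : SimRel C Pd ar par D) {i j : ℕ} (h : i ≠ j) :
    termSim R (.var i) (.var j) = ⊥ := by
  simp [termSim, h]

theorem termSim_var_app (R : SimRel C Pd ar par D) (i : ℕ) (c : C) (ts : TermVec C ar (ar c)) :
    termSim R (.var i) (.app c ts) = ⊥ := by
  simp [termSim]

theorem termSim_app_var (R : SimRel C Pd ar par D) (i : ℕ) (c : C) (ts : TermVec C ar (ar c)) :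
    termSim R (.app c ts) (.var i) = ⊥ := by
  simp [termSim]

theorem termSim_app_app (R : SimRel C Pd ar par D) (c c' : C) (ts : TermVec C ar (ar c))
    (ss : TermVec C ar (ar c')) :
    termSim R (.app c ts) (.app c' ss) = R.simC c c' ⊓ vecSim R ts ss := by
  simp only [termSim]

theorem vecSim_cons_cons (R : SimRel C Pd ar par D) {n m : ℕ} (t s : Term C ar)
    (ts : TermVec C ar n) (ss : TermVec C ar m) :
    vecSim R (.cons t ts) (.cons s ss) = termSim R t s ⊓ vecSim R ts ss := by
  simp only [vecSim]

mutual
  theorem termSim_symm (R : SimRel C Pd ar par D) :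
      ∀ t s : Term C ar, termSim R t s = termSim R s t
    | .var i, .var j => by simp [termSim, eq_comm]
    | .var i, .app c ts => by simp [termSim]
    | .app c ts, .var i => by simp [termSim]
    | .app c ts, .app c' ss => by
        simp [termSim, R.simC_symm c c', vecSim_symm R ts ss]
  theorem vecSim_symm (R : SimRel C Pd ar par D) :
      ∀ {n m : ℕ} (ts : TermVec C ar n) (ss : TermVec C ar m), vecSim R ts ss = vecSim R ss ts
    | _, _, .nil, .nil => rfl
    | _, _, .nil, .cons s ss => by simp [vecSim]
    | _, _, .cons t ts, .nil => by simp [vecSim]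
    | _, _, .cons t ts, .cons s ss => by
        simp [vecSim, termSim_symm R t s, vecSim_symm R ts ss]
end

theorem inf_inf_le_of_le {α : Type*} [Lattice α] {a b a' b' x y : α} (hx : a ⊓ b ≤ x) (hy : a' ⊓ b' ≤ y) :
    (a ⊓ a') ⊓ (b ⊓ b') ≤ x ⊓ y := by
  rw [inf_inf_inf_comm]
  exact inf_le_inf hx hy

mutual
  theorem termSim_trans (R : SimRel C Pd ar par D) :
      ∀ t s u : Term C ar, termSim R t s ⊓ termSim R s u ≤ termSim R t u
    | .var i, .var j, .var k => by
        by_cases h : i = j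
        · simp [termSim, h]
        · simp [termSim, h]
    | .var i, .var j, .app c us => by simp [termSim]
    | .var i, .app c ss, u => by rw [termSim_var_app, bot_inf_eq]; exact bot_le
    | .app c ts, .var j, u => by rw [termSim_app_var, bot_inf_eq]; exact bot_le
    | .app c ts, .app c' ss, .var k => by rw [termSim_app_var R k c' ss, inf_bot_eq]; exact bot_le
    | .app c ts, .app c' ss, .app c'' us => by
        simp only [termSim]
        exact inf_inf_le_of_le (R.simC_trans c c' c'') (vecSim_trans R ts ss us)
  theorem vecSim_trans (R : SimRel C Pd ar par D) :
      ∀ {n m k : ℕ} (ts : TermVec C ar n) (ss : TermVec C ar m) (us : TermVec C ar k),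
        vecSim R ts ss ⊓ vecSim R ss us ≤ vecSim R ts us
    | _, _, _, .nil, .nil, us => by simp [vecSim]
    | _, _, _, .nil, .cons s ss, us => by simp [vecSim]
    | _, _, _, .cons t ts, .nil, us => by simp [vecSim]
    | _, _, _, .cons t ts, .cons s ss, .nil => by simp [vecSim]
    | _, _, _, .cons t ts, .cons s ss, .cons u us => by
        simp only [vecSim]
        exact inf_inf_le_of_le (termSim_trans R t s u) (vecSim_trans R ts ss us)
end

def Subst.comp (θ σ : Subst C ar) : Subst C ar := fun i => (θ i).subst σ

mutual
  theorem Term.subst_subst (θ σ : Subst C ar) :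
      ∀ t : Term C ar, (t.subst θ).subst σ = t.subst (θ.comp σ)
    | .var i => by simp [Term.subst, Subst.comp]
    | .app c ts => by simp [Term.subst, TermVec.subst_subst θ σ ts]
  theorem TermVec.subst_subst (θ σ : Subst C ar) :
      ∀ {n : ℕ} (ts : TermVec C ar n), (ts.subst θ).subst σ = ts.subst (θ.comp σ)
    | _, .nil => by simp [TermVec.subst]
    | _, .cons t ts => by
        simp [TermVec.subst, Term.subst_subst θ σ t, TermVec.subst_subst θ σ ts]
end

mutual
  theorem termSim_le_subst (R : SimRel C Pd ar par D) (θ : Subst C ar) :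
      ∀ t s : Term C ar, termSim R t s ≤ termSim R (t.subst θ) (s.subst θ)
    | .var i, .var j => by
        by_cases h : i = j
        · simp [h, termSim_refl]
        · simp [termSim, h]
    | .var i, .app c ts => by simp [termSim]
    | .app c ts, .var i => by simp [termSim]
    | .app c ts, .app c' ss => by
        simp only [termSim, Term.subst]
        exact inf_le_inf_left _ (vecSim_le_subst R θ ts ss)
  theorem vecSim_le_subst (R : SimRel C Pd ar par D) (θ : Subst C ar) :
      ∀ {n m : ℕ} (ts : TermVec C ar n) (ss : TermVec C ar m),
        vecSim R ts ss ≤ vecSim R (ts.subst θ) (ss.subst θ)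
    | _, _, .nil, .nil => le_rfl
    | _, _, .nil, .cons s ss => by simp [vecSim]
    | _, _, .cons t ts, .nil => by simp [vecSim]
    | _, _, .cons t ts, .cons s ss => by
        simp only [vecSim, TermVec.subst]
        exact inf_le_inf (termSim_le_subst R θ t s) (vecSim_le_subst R θ ts ss)
end

mutual
  theorem le_termSim_subst_subst (R : SimRel C Pd ar par D) {θ θ' : Subst C ar} {δ : D}
      (h : ∀ y, δ ≤ termSim R (θ y) (θ' y)) :
      ∀ t : Term C ar, δ ≤ termSim R (t.subst θ) (t.subst θ')
    | .var i => by simpa [Term.subst] using h i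
    | .app c ts => by
        simpa [termSim, Term.subst, R.simC_refl] using le_vecSim_subst_subst R h ts
  theorem le_vecSim_subst_subst (R : SimRel C Pd ar par D) {θ θ' : Subst C ar} {δ : D}
      (h : ∀ y, δ ≤ termSim R (θ y) (θ' y)) :
      ∀ {n : ℕ} (ts : TermVec C ar n), δ ≤ vecSim R (ts.subst θ) (ts.subst θ')
    | _, .nil => by simp [vecSim, TermVec.subst]
    | _, .cons t ts => by
        simp only [vecSim, TermVec.subst]
        exact le_inf (le_termSim_subst_subst R h t) (le_vecSim_subst_subst R h ts)
end

mutual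
  def Term.vars : Term C ar → List ℕ
    | .var i => [i]
    | .app _ ts => ts.vars
  def TermVec.vars : ∀ {n : ℕ}, TermVec C ar n → List ℕ
    | _, .nil => []
    | _, .cons t ts => t.vars ++ ts.vars
end

mutual
  theorem Term.subst_congr {θ θ' : Subst C ar} :
      ∀ t : Term C ar, (∀ v ∈ t.vars, θ v = θ' v) → t.subst θ = t.subst θ'
    | .var i, h => by simpa [Term.vars, Term.subst] using h
    | .app c ts, h => by
        simp only [Term.subst]
        rw [TermVec.subst_congr ts (by simpa [Term.vars] using h)]
  theorem TermVec.subst_congr {θ θ' : Subst C ar} :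
      ∀ {n : ℕ} (ts : TermVec C ar n), (∀ v ∈ ts.vars, θ v = θ' v) → ts.subst θ = ts.subst θ'
    | _, .nil, _ => by simp [TermVec.subst]
    | _, .cons t ts, h => by
        simp only [TermVec.vars, List.mem_append] at h
        simp only [TermVec.subst]
        rw [Term.subst_congr t fun v hv => h v (.inl hv),
          TermVec.subst_congr ts fun v hv => h v (.inr hv)]
end

theorem infList_append (l l' : List D) : infList (l ++ l') = infList l ⊓ infList l' := by
  induction l with
  | nil => simp [infList]
  | cons a l ih => simp only [infList, List.cons_append, List.foldr_cons, inf_assoc] at ih ⊢; rw [ih]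

theorem le_infList {l : List D} {δ : D} (h : ∀ a ∈ l, δ ≤ a) : δ ≤ infList l := by
  induction l with
  | nil => simp [infList]
  | cons a l ih =>
    exact le_inf (h a (by simp)) (ih fun b hb => h b (by simp [hb]))

theorem infList_le {l : List D} {a : D} (h : a ∈ l) : infList l ≤ a := by
  induction l with
  | nil => simp at h
  | cons b l ih =>
    rcases List.mem_cons.1 h with rfl | h
    · exact inf_le_left
    · exact inf_le_right.trans (ih h)

theorem condsInf_append (R : SimRel C Pd ar par D) (θ : Subst C ar) (l l' : List (ℕ × ℕ)) :
    condsInf R θ (l ++ l') = condsInf R θ l ⊓ condsInf R θ l' := by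
  simp [condsInf, infList_append]

mutual
  theorem condsInf_le_termSim_lin (R : SimRel C Pd ar par D) (θ : Subst C ar) :
      ∀ (t : Term C ar) (seen : List ℕ) (fresh : ℕ),
        condsInf R θ (linTerm t seen fresh).2.2.2 ≤
          termSim R (t.subst θ) ((linTerm t seen fresh).1.subst θ)
    | .var x, seen, fresh => by
        by_cases h : x ∈ seen
        · simp [linTerm, h, condsInf, infList, Term.subst]
        · simp [linTerm, h, Term.subst, termSim_refl]
    | .app c ts, seen, fresh => by
        simpa [linTerm, Term.subst, termSim, R.simC_refl] using
          condsInf_le_vecSim_lin R θ ts seen fresh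
  theorem condsInf_le_vecSim_lin (R : SimRel C Pd ar par D) (θ : Subst C ar) :
      ∀ {n : ℕ} (ts : TermVec C ar n) (seen : List ℕ) (fresh : ℕ),
        condsInf R θ (linVec ts seen fresh).2.2.2 ≤
          vecSim R (ts.subst θ) ((linVec ts seen fresh).1.subst θ)
    | _, .nil, seen, fresh => by simp [linVec, TermVec.subst, vecSim]
    | _, .cons t ts, seen, fresh => by
        simp only [linVec, TermVec.subst, vecSim, condsInf_append]
        exact inf_le_inf (condsInf_le_termSim_lin R θ t seen fresh)
          (condsInf_le_vecSim_lin R θ ts _ _)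
end

/-- Bookkeeping satisfied by the output of a linearization: `vs` are the variables of the
linearized expression, all original variables being below `m`. -/
structure LinInv (m : ℕ) (seen seen' : List ℕ) (fresh fresh' : ℕ) (vs : List ℕ)
    (conds : List (ℕ × ℕ)) : Prop where
  fresh_le : fresh ≤ fresh'
  seen_subset : seen ⊆ seen'
  seen_lt : ∀ v ∈ seen', v < m
  mem_vars : ∀ v ∈ vs, (v < m ∧ v ∉ seen ∧ v ∈ seen') ∨ (fresh ≤ v ∧ v < fresh')
  nodup : vs.Nodup
  conds_lt : ∀ p ∈ conds, p.1 < m ∧ p.2 < fresh'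

theorem LinInv.append {m : ℕ} {s₀ s₁ s₂ : List ℕ} {f₀ f₁ f₂ : ℕ} {vs ws : List ℕ}
    {cs ds : List (ℕ × ℕ)} (h : LinInv m s₀ s₁ f₀ f₁ vs cs) (h' : LinInv m s₁ s₂ f₁ f₂ ws ds)
    (hm : m ≤ f₀) : LinInv m s₀ s₂ f₀ f₂ (vs ++ ws) (cs ++ ds) where
  fresh_le := h.fresh_le.trans h'.fresh_le
  seen_subset := fun _ hv => h'.seen_subset (h.seen_subset hv)
  seen_lt := h'.seen_lt
  mem_vars v hv := by
    have := h.fresh_le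
    have := h'.fresh_le
    rcases List.mem_append.1 hv with hv | hv
    · rcases h.mem_vars v hv with ⟨h1, h2, h3⟩ | h1
      · exact .inl ⟨h1, h2, h'.seen_subset h3⟩
      · right; omega
    · rcases h'.mem_vars v hv with ⟨h1, h2, h3⟩ | h1
      · exact .inl ⟨h1, fun h4 => h2 (h.seen_subset h4), h3⟩
      · right; omega
  nodup := by
    refine h.nodup.append h'.nodup fun v hv hw => ?_
    have := h.fresh_le
    rcases h.mem_vars v hv with ⟨h1, h2, h3⟩ | h1 <;>
      rcases h'.mem_vars v hw with ⟨h4, h5, h6⟩ | h4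
    · exact h5 h3
    · omega
    · omega
    · omega
  conds_lt p hp := by
    have := h'.fresh_le
    rcases List.mem_append.1 hp with hp | hp
    · exact ⟨(h.conds_lt p hp).1, (h.conds_lt p hp).2.trans_le this⟩
    · exact h'.conds_lt p hp

mutual
  theorem linTerm_inv {m : ℕ} :
      ∀ (t : Term C ar) (seen : List ℕ) (fresh : ℕ), t.maxVar ≤ m → m ≤ fresh →
        (∀ v ∈ seen, v < m) →
        LinInv m seen (linTerm t seen fresh).2.1 fresh (linTerm t seen fresh).2.2.1
          (linTerm t seen fresh).1.vars (linTerm t seen fresh).2.2.2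
    | .var x, seen, fresh, ht, hm, hs => by
        simp only [Term.maxVar] at ht
        by_cases h : x ∈ seen
        · simp only [linTerm, h, if_true]
          exact ⟨by omega, fun _ h => h, hs, by simp [Term.vars], by simp [Term.vars],
            by simp; omega⟩
        · simp only [linTerm, h, if_false]
          refine ⟨le_rfl, by simp, ?_, ?_, by simp [Term.vars], by simp⟩
          · simp only [List.mem_cons, forall_eq_or_imp]
            exact ⟨ht, hs⟩
          · simp [Term.vars, h]; omega
    | .app c ts, seen, fresh, ht, hm, hs => by
        simpa only [linTerm, Term.vars] using
          linVec_inv ts seen fresh (by simpa [Term.maxVar] using ht) hm hs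
  theorem linVec_inv {m : ℕ} :
      ∀ {n : ℕ} (ts : TermVec C ar n) (seen : List ℕ) (fresh : ℕ), ts.maxVar ≤ m → m ≤ fresh →
        (∀ v ∈ seen, v < m) →
        LinInv m seen (linVec ts seen fresh).2.1 fresh (linVec ts seen fresh).2.2.1
          (linVec ts seen fresh).1.vars (linVec ts seen fresh).2.2.2
    | _, .nil, seen, fresh, ht, hm, hs => by
        simp only [linVec, TermVec.vars]
        exact ⟨le_rfl, fun _ h => h, hs, by simp, by simp, by simp⟩
    | _, .cons t ts, seen, fresh, ht, hm, hs => by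
        simp only [TermVec.maxVar, max_le_iff] at ht
        have h := linTerm_inv t seen fresh ht.1 hm hs
        have h' := linVec_inv ts (linTerm t seen fresh).2.1 (linTerm t seen fresh).2.2.1 ht.2
          (hm.trans h.fresh_le) h.seen_lt
        simpa only [linVec, TermVec.vars] using h.append h' hm
end

mutual
  theorem linTerm_recover {m : ℕ} :
      ∀ (t : Term C ar) (seen : List ℕ) (fresh : ℕ), t.maxVar ≤ m → m ≤ fresh →
        (∀ v ∈ seen, v < m) → ∀ θ₀ : Subst C ar, (∀ v < m, θ₀ v = .var v) →
        ∃ θ : Subst C ar, (∀ v < fresh, θ v = θ₀ v) ∧ (linTerm t seen fresh).1.subst θ = t ∧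
          ∀ p ∈ (linTerm t seen fresh).2.2.2, θ p.1 = θ p.2
    | .var x, seen, fresh, ht, hm, hs, θ₀, h₀ => by
        simp only [Term.maxVar] at ht
        by_cases h : x ∈ seen
        · refine ⟨fun v => if v = fresh then .var x else θ₀ v, fun v hv => by simp [hv.ne], ?_, ?_⟩
          · simp [linTerm, h, Term.subst]
          · have : x ≠ fresh := by omega
            simp [linTerm, h, this, h₀ x ht]
        · refine ⟨θ₀, fun _ _ => rfl, ?_, ?_⟩
          · simp [linTerm, h, Term.subst, h₀ x ht]
          · simp [linTerm, h]
    | .app c ts, seen, fresh, ht, hm, hs, θ₀, h₀ => by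
        obtain ⟨θ, h1, h2, h3⟩ :=
          linVec_recover ts seen fresh (by simpa [Term.maxVar] using ht) hm hs θ₀ h₀
        exact ⟨θ, h1, by simp [linTerm, Term.subst, h2], by simpa only [linTerm] using h3⟩
  theorem linVec_recover {m : ℕ} :
      ∀ {n : ℕ} (ts : TermVec C ar n) (seen : List ℕ) (fresh : ℕ), ts.maxVar ≤ m → m ≤ fresh →
        (∀ v ∈ seen, v < m) → ∀ θ₀ : Subst C ar, (∀ v < m, θ₀ v = .var v) →
        ∃ θ : Subst C ar, (∀ v < fresh, θ v = θ₀ v) ∧ (linVec ts seen fresh).1.subst θ = ts ∧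
          ∀ p ∈ (linVec ts seen fresh).2.2.2, θ p.1 = θ p.2
    | _, .nil, seen, fresh, ht, hm, hs, θ₀, h₀ =>
        ⟨θ₀, fun _ _ => rfl, by simp [linVec, TermVec.subst], by simp [linVec]⟩
    | _, .cons t ts, seen, fresh, ht, hm, hs, θ₀, h₀ => by
        simp only [TermVec.maxVar, max_le_iff] at ht
        have hi := linTerm_inv t seen fresh ht.1 hm hs
        have hle := hi.fresh_le
        obtain ⟨θ₁, h1, h2, h3⟩ := linTerm_recover t seen fresh ht.1 hm hs θ₀ h₀
        obtain ⟨θ₂, g1, g2, g3⟩ := linVec_recover ts (linTerm t seen fresh).2.1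
          (linTerm t seen fresh).2.2.1 ht.2 (hm.trans hle) hi.seen_lt θ₁
          fun v hv => (h1 v (by omega)).trans (h₀ v hv)
        refine ⟨θ₂, fun v hv => (g1 v (by omega)).trans (h1 v hv), ?_, ?_⟩
        · have : (linTerm t seen fresh).1.subst θ₂ = t := by
            rw [Term.subst_congr (θ' := θ₁) _ fun v hv => g1 v ?_, h2]
            rcases hi.mem_vars v hv with h | h <;> omega
          simp only [linVec, TermVec.subst, this, g2]
        · simp only [linVec, List.mem_append]
          rintro p (hp | hp)
          · have := hi.conds_lt p hp
            rw [g1 _ (by omega), g1 _ (by omega), h3 p hp]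
          · exact g3 p hp
end

theorem inf_ne_bot {a b : D} (h : a ⊓ b ≠ ⊥) : a ≠ ⊥ ∧ b ≠ ⊥ :=
  ⟨by rintro rfl; simp at h, by rintro rfl; simp at h⟩

mutual
  /-- If `s` is a variant of the linear pattern `t`, every term similar to an instance of `s`
  is itself an instance of a variant of `t`, through a similar substitution. -/
  theorem exists_variant_of_termSim (R : SimRel C Pd ar par D) (τ : Subst C ar) :
      ∀ t s u : Term C ar, t.vars.Nodup → termSim R t s ≠ ⊥ → termSim R (s.subst τ) u ≠ ⊥ →
        ∃ (s₁ : Term C ar) (θ : Subst C ar), s₁.subst θ = u ∧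
          termSim R t s ⊓ termSim R (s.subst τ) u ≤ termSim R t s₁ ∧
          (∀ y, termSim R (s.subst τ) u ≤ termSim R (τ y) (θ y)) ∧ s₁.vars ⊆ t.vars
    | .var i, .var j, u, _, h, _ => by
        by_cases hij : i = j
        · subst hij
          refine ⟨.var i, fun y => if y = i then u else τ y, if_pos rfl,
            le_top.trans (termSim_refl R _).ge, fun y => ?_, fun _ h => h⟩
          by_cases hy : y = i
          · subst hy; simp [Term.subst]
          · simp [hy, termSim_refl]
        · exact absurd (termSim_var_of_ne R hij) h
    | .var i, .app c ss, u, _, h, _ => absurd (termSim_var_app R i c ss) h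
    | .app c ts, .var j, u, _, h, _ => absurd (termSim_app_var R j c ts) h
    | .app c ts, .app c' ss, .var k, _, _, h => absurd (termSim_app_var R k c' (ss.subst τ)) h
    | .app c ts, .app c' ss, .app c'' us, hn, h, h' => by
        simp only [termSim_app_app, Term.subst, Term.vars] at hn h h' ⊢
        obtain ⟨s₁, θ, h1, h2, h3, h4⟩ := exists_variant_of_vecSim R τ ts ss us hn
          (inf_ne_bot h).2 (inf_ne_bot h').2
        refine ⟨.app c'' s₁, θ, by simp [Term.subst, h1], ?_, fun y => inf_le_right.trans (h3 y),
          by simpa only [Term.vars] using h4⟩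
        rw [termSim_app_app]
        exact inf_inf_le_of_le (R.simC_trans c c' c'') h2
  theorem exists_variant_of_vecSim (R : SimRel C Pd ar par D) (τ : Subst C ar) :
      ∀ {n m k : ℕ} (ts : TermVec C ar n) (ss : TermVec C ar m) (us : TermVec C ar k),
        ts.vars.Nodup → vecSim R ts ss ≠ ⊥ → vecSim R (ss.subst τ) us ≠ ⊥ →
        ∃ (s₁ : TermVec C ar k) (θ : Subst C ar), s₁.subst θ = us ∧
          vecSim R ts ss ⊓ vecSim R (ss.subst τ) us ≤ vecSim R ts s₁ ∧
          (∀ y, vecSim R (ss.subst τ) us ≤ termSim R (τ y) (θ y)) ∧ s₁.vars ⊆ ts.vars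
    | _, _, _, .nil, .nil, .nil, _, _, _ =>
        ⟨.nil, τ, by simp [TermVec.subst], by simp [vecSim], by simp [termSim_refl], by simp⟩
    | _, _, _, .nil, .nil, .cons u us, _, _, h => by simp [vecSim, TermVec.subst] at h
    | _, _, _, .nil, .cons s ss, us, _, h, _ => by simp [vecSim] at h
    | _, _, _, .cons t ts, .nil, us, _, h, _ => by simp [vecSim] at h
    | _, _, _, .cons t ts, .cons s ss, .nil, _, _, h => by simp [vecSim, TermVec.subst] at h
    | _, _, _, .cons t ts, .cons s ss, .cons u us, hn, h, h' => by
        simp only [vecSim_cons_cons, TermVec.subst, TermVec.vars] at hn h h' ⊢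
        rw [List.nodup_append'] at hn
        obtain ⟨hn1, hn2, hd⟩ := hn
        obtain ⟨s₁, θ₁, h1, h2, h3, h4⟩ := exists_variant_of_termSim R τ t s u hn1
          (inf_ne_bot h).1 (inf_ne_bot h').1
        obtain ⟨s₂, θ₂, g1, g2, g3, g4⟩ := exists_variant_of_vecSim R τ ts ss us hn2
          (inf_ne_bot h).2 (inf_ne_bot h').2
        refine ⟨.cons s₁ s₂, fun y => if y ∈ t.vars then θ₁ y else θ₂ y, ?_, ?_, fun y => ?_, ?_⟩
        · exact congrArg₂ TermVec.cons
            ((Term.subst_congr s₁ fun v hv => if_pos (h4 hv)).trans h1)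
            ((TermVec.subst_congr s₂ fun v hv => if_neg fun hv' => hd hv' (g4 hv)).trans g1)
        · rw [vecSim_cons_cons]
          exact inf_inf_le_of_le h2 g2
        · by_cases hy : y ∈ t.vars
          · simpa [hy] using inf_le_left.trans (h3 y)
          · simpa [hy] using inf_le_right.trans (g3 y)
        · simp only [TermVec.vars]
          exact List.append_subset.2 ⟨List.subset_append_of_subset_left _ h4,
            List.subset_append_of_subset_right _ g4⟩
end

theorem QualDom.att_le_left (Q : QualDom D) (a b : D) : Q.att a b ≤ a :=
  (Q.att_mono a a b ⊤ le_rfl le_top).trans (Q.att_top a).le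

theorem QualDom.att_le_right (Q : QualDom D) (a b : D) : Q.att a b ≤ b :=
  Q.att_comm a b ▸ Q.att_le_left b a

theorem RInstAtom.refl (R : SimRel C Pd ar par D) (A : Atom C Pd ar par)
    (h : (⊤ : D) ≠ ⊥) : RInstAtom R A A ⊤ := by
  obtain ⟨θ, -, h2, h3⟩ := linVec_recover A.args [] A.args.maxVar le_rfl le_rfl (by simp)
    Term.var fun _ _ => rfl
  refine ⟨(linAtom A).1, θ, ?_, ?_, h⟩
  · simp [Atom.subst, linAtom, linAtomFrom, h2]
  · refine (top_unique (le_inf ?_ (le_infList fun a ha => ?_))).symm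
    · simp [atomSim, R.simP_refl, vecSim_refl]
    · obtain ⟨p, hp, rfl⟩ := List.mem_map.1 ha
      simp [h3 p hp, termSim_refl]

theorem RInstAtom.exists_le_atomSim_subst {R : SimRel C Pd ar par D} {A A' : Atom C Pd ar par}
    {δ : D} (h : RInstAtom R A A' δ) : ∃ σ : Subst C ar, δ ≤ atomSim R (A.subst σ) A' := by
  obtain ⟨As, θ, rfl, rfl, -⟩ := h
  refine ⟨θ, le_inf (inf_le_left.trans inf_le_left) ?_⟩
  refine le_trans (le_inf (inf_le_right.trans (condsInf_le_vecSim_lin R θ A.args [] _))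
    (inf_le_left.trans (inf_le_right.trans (vecSim_le_subst R θ _ _)))) (vecSim_trans R _ _ _)

theorem Clause.linHead_vars_nodup (Cl : Clause C Pd ar par D) : Cl.linHead.1.args.vars.Nodup :=
  (linVec_inv Cl.head.args [] Cl.maxVar (le_max_left _ _) le_rfl (by simp)).nodup

theorem le_atomSim_subst_subst (R : SimRel C Pd ar par D) {θ σ θ' : Subst C ar} {δ : D}
    (h : ∀ y, δ ≤ termSim R (θ.comp σ y) (θ' y)) (A : Atom C Pd ar par) :
    δ ≤ atomSim R ((A.subst θ).subst σ) (A.subst θ') := by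
  simpa [atomSim, Atom.subst, R.simP_refl, TermVec.subst_subst] using
    le_vecSim_subst_subst R h A.args

/-- Instances of a clause are transported along a substitution and a similarity of the head. -/
theorem exists_variant_of_atomSim {R : SimRel C Pd ar par D} {Cl : Clause C Pd ar par D}
    {As A' : Atom C Pd ar par} {θ σ : Subst C ar} {δ : D}
    (hδ : δ ≤ atomSim R ((As.subst θ).subst σ) A') (hne : δ ≠ ⊥) (hAs : atomSim R Cl.linHead.1 As ≠ ⊥) :
    ∃ (A₁ : Atom C Pd ar par) (θ₁ : Subst C ar), A₁.subst θ₁ = A' ∧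
      (atomSim R Cl.linHead.1 As ⊓ condsInf R θ Cl.linHead.2) ⊓ δ ≤
        atomSim R Cl.linHead.1 A₁ ⊓ condsInf R θ₁ Cl.linHead.2 ∧
      ∀ y, δ ≤ termSim R (θ.comp σ y) (θ₁ y) := by
  have hne' := inf_ne_bot (ne_bot_of_le_ne_bot hne hδ)
  simp only [Atom.subst, TermVec.subst_subst] at hne' hδ
  simp only [atomSim] at hδ hAs
  obtain ⟨s₁, θ₁, h1, h2, h3, -⟩ := exists_variant_of_vecSim R (θ.comp σ) _ _ _
    Cl.linHead_vars_nodup (inf_ne_bot hAs).2 hne'.2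
  have h3' : ∀ y, δ ≤ termSim R (θ.comp σ y) (θ₁ y) :=
    fun y => hδ.trans (inf_le_right.trans (h3 y))
  refine ⟨⟨A'.pred, s₁⟩, θ₁, by simp [Atom.subst, h1], le_inf ?_ (le_infList fun a ha => ?_), h3'⟩
  · refine (inf_le_inf inf_le_left hδ).trans ?_
    exact inf_inf_le_of_le (R.simP_trans _ _ _) h2
  · obtain ⟨p, hp, rfl⟩ := List.mem_map.1 ha
    have hc : condsInf R θ Cl.linHead.2 ≤ termSim R (θ.comp σ p.1) (θ.comp σ p.2) :=
      (infList_le (List.mem_map_of_mem hp)).trans (termSim_le_subst R σ _ _)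
    have h21 := termSim_symm R (θ.comp σ p.1) (θ₁ p.1) ▸ h3' p.1
    have hx : ∀ z, z ≤ δ → z ≤ condsInf R θ Cl.linHead.2 → z ≤ termSim R (θ₁ p.1) (θ₁ p.2) :=
      fun z hz hz' => (le_inf ((le_inf (hz.trans h21) (hz'.trans hc)).trans (termSim_trans R _ _ _))
        (hz.trans (h3' p.2))).trans (termSim_trans R _ _ _)
    exact hx _ inf_le_right (inf_le_left.trans inf_le_right)

theorem SQHL.of_atomSim {R : SimRel C Pd ar par D} {Q : QualDom D}
    {Pr : List (Clause C Pd ar par D)} {A : Atom C Pd ar par} {d : D} (h : SQHL R Q Pr A d) :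
    ∀ (σ : Subst C ar) (A' : Atom C Pd ar par) (δ d' : D), δ ≤ atomSim R (A.subst σ) A' →
      d' ≠ ⊥ → d' ≤ Q.att d δ → SQHL R Q Pr A' d' := by
  induction h with
  | mp Cl hCl Cl' δ₀ ds d hinst hlen hprem hd hle ih =>
    intro σ A' δ d' hδ hd' hle'
    obtain ⟨As, θ, rfl, hδ₀, rfl⟩ := hinst
    have hδne : δ ≠ ⊥ := by rintro rfl; exact hd' (le_bot_iff.1 (hle'.trans (Q.att_bot d).le))
    obtain ⟨A₁, θ₁, rfl, h2, h3⟩ := exists_variant_of_atomSim hδ hδne (inf_ne_bot hδ₀).1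
    set δ₀ := atomSim R Cl.linHead.1 As ⊓ condsInf R θ Cl.linHead.2
    have key : d' ≤ Q.att Cl.att (Q.att (δ₀ ⊓ infList ds) δ) := by
      rw [← Q.att_assoc]
      exact hle'.trans (Q.att_mono _ _ _ _ hle le_rfl)
    have hne : Q.att (δ₀ ⊓ infList ds) δ ≠ ⊥ := by
      intro h
      rw [h, Q.att_bot] at key
      exact hd' (le_bot_iff.1 key)
    have hle₁ : Q.att (δ₀ ⊓ infList ds) δ ≤
        atomSim R Cl.linHead.1 A₁ ⊓ condsInf R θ₁ Cl.linHead.2 :=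
      le_trans (le_inf ((Q.att_le_left _ _).trans inf_le_left) (Q.att_le_right _ _)) h2
    have hds : ∀ x ∈ ds, Q.att (δ₀ ⊓ infList ds) δ ≤ Q.att x δ := fun x hx =>
      Q.att_mono _ _ _ _ (inf_le_right.trans (infList_le hx)) le_rfl
    refine SQHL.mp Cl hCl ⟨A₁.subst θ₁, Cl.att, Cl.body.map (Atom.subst · θ₁)⟩ _
      (ds.map (Q.att · δ)) d' ⟨A₁, θ₁, rfl, ne_bot_of_le_ne_bot hne hle₁, rfl⟩
      (by simpa using hlen) (fun i h1 h2 => ?_) hd' ?_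
    · simp only [List.length_map] at h1 h2
      simp only [List.get_eq_getElem, List.getElem_map]
      refine ih i (by simpa using h1) h2 σ _ δ _ ?_
        (ne_bot_of_le_ne_bot hne (hds _ (List.getElem_mem h2))) le_rfl
      simp only [List.get_eq_getElem, List.getElem_map]
      exact le_atomSim_subst_subst R h3 _
    · refine key.trans (Q.att_mono _ _ _ _ le_rfl (le_inf hle₁ (le_infList fun a ha => ?_)))
      obtain ⟨x, hx, rfl⟩ := List.mem_map.1 ha
      exact hds x hx

theorem SQHL.ne_bot {R : SimRel C Pd ar par D} {Q : QualDom D}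
    {Pr : List (Clause C Pd ar par D)} {A : Atom C Pd ar par} {d : D} (h : SQHL R Q Pr A d) :
    d ≠ ⊥ := by
  cases h with
  | mp _ _ _ _ _ _ _ _ _ hd _ => exact hd

theorem SQHL.memQ_of_isModel {R : SimRel C Pd ar par D} {Q : QualDom D}
    {Pr : List (Clause C Pd ar par D)} {I : Set (QAtom C Pd ar par D)} (hI : IsInterp R Q I)
    (hM : IsModel R Q Pr I) {A : Atom C Pd ar par} {d : D} (h : SQHL R Q Pr A d) :
    memQ I A d := by
  induction h with
  | mp Cl hCl Cl' δ ds d hinst hlen hprem hd hle ih =>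
    obtain ⟨q, hq, hqe⟩ := hM Cl hCl Cl' δ hinst ds hlen ih _ rfl (ne_bot_of_le_ne_bot hd hle)
    refine ⟨⟨(Cl'.head, d), hd⟩, hI q hq _ ⟨⊤, ?_, ?_⟩, rfl⟩
    · rw [hqe]
      exact RInstAtom.refl R _ (ne_bot_of_le_ne_bot hd le_top)
    · rw [hqe, Q.att_top]
      exact hle

/-- For any `SQLP(R,D)` program `Pr`, the least Herbrand model of `Pr` — the least
(w.r.t. set inclusion) open Herbrand interpretation over `(R,D)` that is a model of
every clause of `Pr` — exists and equals `M_Pr = {A#d | Pr ⊢_SQHL(R,D) A#d}`, the set of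
all `D`-qualified atoms derivable from `Pr` in the inference system `SQHL(R,D)`. -/
theorem least_Herbrand_model {C Pd : Type} {ar : C → ℕ} {par : Pd → ℕ}
    {D : Type} [Lattice D] [BoundedOrder D] (Q : QualDom D) (R : SimRel C Pd ar par D)
    (Pr : List (Clause C Pd ar par D)) (hPr : ∀ Cl ∈ Pr, Cl.att ≠ ⊥) :
    IsLeast {I : Set (QAtom C Pd ar par D) | IsInterp R Q I ∧ IsModel R Q Pr I}
      {q : QAtom C Pd ar par D | SQHL R Q Pr q.1.1 q.1.2} := by
  refine ⟨⟨fun a ha b ⟨δ, hδ, hle⟩ => ?_, fun Cl hCl Cl' δ hinst ds hlen hprem e he hne => ?_⟩,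
    fun I hI q hq => ?_⟩
  · obtain ⟨σ, hσ⟩ := hδ.exists_le_atomSim_subst
    exact SQHL.of_atomSim ha σ _ δ _ hσ b.2 hle
  · refine ⟨⟨(Cl'.head, e), hne⟩, ?_, rfl⟩
    refine SQHL.mp Cl hCl Cl' δ ds e hinst hlen (fun i h1 h2 => ?_) hne he.le
    obtain ⟨q, hq, hqe⟩ := hprem i h1 h2
    have hq' : SQHL R Q Pr q.1.1 q.1.2 := hq
    rwa [hqe] at hq'
  · obtain ⟨q', hq', he⟩ := SQHL.memQ_of_isModel hI.1 hI.2 hq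
    rwa [← Subtype.ext (a1 := q') (a2 := q) he]
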